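/- Let E be a Banach space, let d ≥ 1, let ν ∈ (0,1), let f : ℝ^d → E be a strongly measurable function, and let Q⁰ be an axis-parallel cube. Then there exists a collection 𝒮 of dyadic subcubes of Q⁰ that is pairwise nearly disjoint with parameter ν, such that for almost every x ∈ Q⁰ and for every quasi-optimal center of oscillation c of f on Q⁰ with a 1/4-portion disregarded, one has ‖f(x) − c‖ ≤ 12 · Σ_{Q ∈ 𝒮} ω_{(1−ν)·2^{−d−2}}(f; Q) · 1_Q(x). -/

import Mathlib

open MeasureTheory Set

/-- The least bound `ρ_λ(f;Q)`: the infimum of all `r ≥ 0` such that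
`|{x ∈ Q : ‖f(x)‖ > r}| ≤ λ|Q|`. -/
noncomputable def leastBound {E : Type*} [NormedAddCommGroup E] {d : ℕ} (lam : ℝ)
    (f : (Fin d → ℝ) → E) (Q : Set (Fin d → ℝ)) : ℝ :=
  sInf {r : ℝ | 0 ≤ r ∧ volume {x ∈ Q | r < ‖f x‖} ≤ ENNReal.ofReal lam * volume Q}

/-- The local oscillation `ω_λ(f;Q) := inf_{c ∈ E} ρ_λ(f - c; Q)`. -/
noncomputable def localOsc {E : Type*} [NormedAddCommGroup E] {d : ℕ} (lam : ℝ)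
    (f : (Fin d → ℝ) → E) (Q : Set (Fin d → ℝ)) : ℝ :=
  ⨅ c : E, leastBound lam (fun x => f x - c) Q

/-- A quasi-optimal center of oscillation of `f` on `Q` with a `λ`-portion disregarded:
any `m ∈ E` with `ρ_λ(f - m; Q) ≤ 2 ω_λ(f;Q)`. -/
def IsQuasiCenter {E : Type*} [NormedAddCommGroup E] {d : ℕ} (lam : ℝ)
    (f : (Fin d → ℝ) → E) (Q : Set (Fin d → ℝ)) (m : E) : Prop :=
  leastBound lam (fun x => f x - m) Q ≤ 2 * localOsc lam f Q

/-- The axis-parallel (half-open) cube with lower corner `a` and side length `l`. -/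
def cube {d : ℕ} (a : Fin d → ℝ) (l : ℝ) : Set (Fin d → ℝ) :=
  univ.pi fun i => Ico (a i) (a i + l)

/-- `R` is a dyadic subcube of the cube with lower corner `a` and side length `l`. -/
def IsDyadicSubcube {d : ℕ} (a : Fin d → ℝ) (l : ℝ) (R : Set (Fin d → ℝ)) : Prop :=
  ∃ (k : ℕ) (m : Fin d → ℕ), (∀ i, m i < 2 ^ k) ∧
    R = univ.pi fun i => Ico (a i + m i * l / 2 ^ k) (a i + (m i + 1) * l / 2 ^ k)

/-- A collection `S` of measurable sets is pairwise nearly disjoint with parameter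
`ν ∈ (0,1)`: each `Q ∈ S` carries a measurable subset `E(Q) ⊆ Q` with `|E(Q)| ≥ ν |Q|`,
and the sets `E(Q)`, `E(Q')` are disjoint for distinct `Q, Q' ∈ S`. -/
def PairwiseNearlyDisjoint {d : ℕ} (ν : ℝ) (S : Set (Set (Fin d → ℝ))) : Prop :=
  ∃ sel : Set (Fin d → ℝ) → Set (Fin d → ℝ),
    (∀ Q ∈ S, MeasurableSet (sel Q) ∧ sel Q ⊆ Q ∧
      ENNReal.ofReal ν * volume Q ≤ volume (sel Q)) ∧
    S.Pairwise fun Q Q' => sel Q ∩ sel Q' = ∅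

/-- The dyadic cube of generation `k` and index `m` of the grid with origin `a` whose cubes of
generation `0` have side length `l`. -/
def dyadicCube {d : ℕ} (a : Fin d → ℝ) (l : ℝ) (k : ℕ) (m : Fin d → ℕ) : Set (Fin d → ℝ) :=
  univ.pi fun i => Ico (a i + m i * l / 2 ^ k) (a i + (m i + 1) * l / 2 ^ k)

/-- The index of the dyadic cube of generation `k` that contains `x`. -/
noncomputable def dyadicIndex {d : ℕ} (a : Fin d → ℝ) (l : ℝ) (k : ℕ) (x : Fin d → ℝ) :
    Fin d → ℕ :=
  fun i => ⌊(x i - a i) * 2 ^ k / l⌋₊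

section DyadicCube

variable {d : ℕ} {a : Fin d → ℝ} {l : ℝ}

lemma measurableSet_dyadicCube (k : ℕ) (m : Fin d → ℕ) :
    MeasurableSet (dyadicCube a l k m) :=
  MeasurableSet.univ_pi fun _ => measurableSet_Ico

lemma mem_dyadicCube_iff (hl : 0 < l) {k : ℕ} {m : Fin d → ℕ} {x : Fin d → ℝ} :
    x ∈ dyadicCube a l k m ↔ a ≤ x ∧ dyadicIndex a l k x = m := by
  simp only [dyadicCube, mem_univ_pi, mem_Ico, dyadicIndex, funext_iff, Pi.le_def, ← forall_and]
  refine forall_congr' fun i => ?_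
  have h2 : (0 : ℝ) < 2 ^ k := by positivity
  have key : a i ≤ x i → (⌊(x i - a i) * 2 ^ k / l⌋₊ = m i ↔
      a i + m i * l / 2 ^ k ≤ x i ∧ x i < a i + (m i + 1) * l / 2 ^ k) := by
    intro hx
    have hx' : 0 ≤ (x i - a i) * 2 ^ k / l :=
      div_nonneg (mul_nonneg (sub_nonneg.2 hx) h2.le) hl.le
    rw [Nat.floor_eq_iff hx', le_div_iff₀ hl, div_lt_iff₀ hl, ← le_sub_iff_add_le',
      ← sub_lt_iff_lt_add', div_le_iff₀ h2, lt_div_iff₀ h2]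
  constructor
  · intro h
    have hx : a i ≤ x i := by
      have : 0 ≤ m i * l / 2 ^ k := by positivity
      linarith [h.1]
    exact ⟨hx, (key hx).2 h⟩
  · rintro ⟨hx, h⟩
    exact (key hx).1 h

lemma dyadicIndex_succ_div_two (k : ℕ) (x : Fin d → ℝ) :
    (fun i => dyadicIndex a l (k + 1) x i / 2) = dyadicIndex a l k x := by
  funext i
  simp only [dyadicIndex]
  rw [← Nat.floor_div_ofNat]
  congr 1
  rw [pow_succ]
  ring

lemma dyadicCube_succ_subset (hl : 0 < l) (k : ℕ) (m : Fin d → ℕ) :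
    dyadicCube a l (k + 1) m ⊆ dyadicCube a l k (fun i => m i / 2) := by
  intro x hx
  rw [mem_dyadicCube_iff hl] at hx ⊢
  rw [← dyadicIndex_succ_div_two, hx.2]
  exact ⟨hx.1, rfl⟩

lemma volume_dyadicCube (k : ℕ) (m : Fin d → ℕ) :
    volume (dyadicCube a l k m) = ENNReal.ofReal (l / 2 ^ k) ^ d := by
  rw [dyadicCube, Real.volume_pi_Ico]
  have : ∀ i, a i + (m i + 1) * l / 2 ^ k - (a i + m i * l / 2 ^ k) = l / 2 ^ k := fun i => by ring
  simp [this]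

lemma volume_dyadicCube_pos (hl : 0 < l) (k : ℕ) (m : Fin d → ℕ) :
    0 < volume (dyadicCube a l k m) := by
  rw [volume_dyadicCube]
  exact ENNReal.pow_pos (ENNReal.ofReal_pos.2 (by positivity)) _

lemma volume_dyadicCube_lt_top (k : ℕ) (m : Fin d → ℕ) : volume (dyadicCube a l k m) < ⊤ := by
  rw [volume_dyadicCube]
  exact ENNReal.pow_lt_top ENNReal.ofReal_lt_top

lemma volume_dyadicCube_eq_two_pow_mul_succ (k : ℕ) (m m' : Fin d → ℕ) :
    volume (dyadicCube a l k m) = 2 ^ d * volume (dyadicCube a l (k + 1) m') := by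
  rw [volume_dyadicCube, volume_dyadicCube, ← mul_pow]
  congr 1
  rw [← ENNReal.ofReal_ofNat 2, ← ENNReal.ofReal_mul (by norm_num)]
  congr 1
  rw [pow_succ]
  field_simp

lemma dyadicCube_zero_zero : dyadicCube a l 0 0 = cube a l := by
  simp [dyadicCube, cube]

lemma dyadicIndex_lt (hl : 0 < l) {x : Fin d → ℝ} (hx : x ∈ cube a l) (k : ℕ) (i : Fin d) :
    dyadicIndex a l k x i < 2 ^ k := by
  have hxi := hx i (mem_univ i)
  rw [mem_Ico] at hxi
  have h2 : (0 : ℝ) < 2 ^ k := by positivity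
  rw [dyadicIndex, Nat.floor_lt (div_nonneg (mul_nonneg (by linarith) h2.le) hl.le),
    div_lt_iff₀ hl, mul_comm]
  push_cast
  exact mul_lt_mul_of_pos_left (by linarith) h2

lemma dyadicCube_subset_cube (hl : 0 < l) {k : ℕ} {m : Fin d → ℕ} (hm : ∀ i, m i < 2 ^ k) :
    dyadicCube a l k m ⊆ cube a l := by
  intro x hx i hi
  have hxi := hx i hi
  rw [mem_Ico] at hxi ⊢
  have h1 : 0 ≤ m i * l / 2 ^ k := by positivity
  have h2 : (m i + 1) * l / 2 ^ k ≤ l := by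
    rw [div_le_iff₀ (by positivity), mul_comm]
    have : ((m i : ℝ) + 1) ≤ 2 ^ k := by exact_mod_cast hm i
    gcongr
  constructor <;> linarith

/-- The dyadic cubes shrinking to almost every point of `s` satisfy Lebesgue's density theorem. -/
lemma ae_tendsto_volume_inter_dyadicCube_div (hl : 0 < l) (s : Set (Fin d → ℝ)) :
    ∀ᵐ x, x ∈ s → a ≤ x → Filter.Tendsto
      (fun k => volume (s ∩ dyadicCube a l k (dyadicIndex a l k x)) /
        volume (dyadicCube a l k (dyadicIndex a l k x))) Filter.atTop (nhds 1) := by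
  have h := IsUnifLocDoublingMeasure.ae_tendsto_measure_inter_div
    (volume : Measure (Fin d → ℝ)) s 1
  filter_upwards [ae_imp_of_ae_restrict h] with x hx hxs hax
  set w : ℕ → Fin d → ℝ := fun k i => a i + dyadicIndex a l k x i * l / 2 ^ k + l / 2 ^ k / 2
  have hball : ∀ k, dyadicCube a l k (dyadicIndex a l k x) =ᵐ[volume]
      Metric.closedBall (w k) (l / 2 ^ k / 2) := by
    intro k
    rw [closedBall_pi _ (by positivity)]
    simp only [Real.closedBall_eq_Icc]
    rw [pi_univ_Icc]
    have hcube : dyadicCube a l k (dyadicIndex a l k x) =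
        univ.pi fun i => Ico (w k i - l / 2 ^ k / 2) (w k i + l / 2 ^ k / 2) := by
      rw [dyadicCube]
      congr 1
      funext i
      congr 1 <;> simp only [w] <;> ring
    rw [hcube]
    exact Measure.univ_pi_Ico_ae_eq_Icc (μ := fun _ : Fin d => (volume : Measure ℝ))
  have hmem : ∀ k, x ∈ Metric.closedBall (w k) (1 * (l / 2 ^ k / 2)) := by
    intro k
    have hxk : x ∈ dyadicCube a l k (dyadicIndex a l k x) := (mem_dyadicCube_iff hl).2 ⟨hax, rfl⟩
    rw [one_mul, closedBall_pi _ (by positivity)]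
    intro i hi
    have := hxk i hi
    simp only [Real.closedBall_eq_Icc]
    refine ⟨le_trans (le_of_eq ?_) this.1, this.2.le.trans (le_of_eq ?_)⟩ <;>
      simp only [w] <;> ring
  have hδ : Filter.Tendsto (fun k : ℕ => l / 2 ^ k / 2) Filter.atTop (nhdsWithin 0 (Ioi 0)) := by
    rw [tendsto_nhdsWithin_iff]
    refine ⟨?_, Filter.Eventually.of_forall fun k => by simp only [mem_Ioi]; positivity⟩
    have := (tendsto_pow_atTop_nhds_zero_of_lt_one (r := (1 / 2 : ℝ)) (by norm_num)
      (by norm_num)).const_mul (l / 2)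
    rw [mul_zero] at this
    refine this.congr fun k => ?_
    rw [one_div, inv_pow]
    ring
  refine (hx hxs w _ hδ (Filter.Eventually.of_forall hmem)).congr fun k => ?_
  rw [measure_congr (hball k), measure_congr (ae_eq_set_inter (ae_eq_refl s) (hball k))]

end DyadicCube

section LocalOscillation

variable {E : Type*} [NormedAddCommGroup E] {d : ℕ} {Q : Set (Fin d → ℝ)}

lemma volume_setOf_lt_le_of_forall_lt {g : (Fin d → ℝ) → E} {r : ℝ} {M : ENNReal}
    (h : ∀ s > r, volume {x ∈ Q | s < ‖g x‖} ≤ M) : volume {x ∈ Q | r < ‖g x‖} ≤ M := by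
  have hU : {x ∈ Q | r < ‖g x‖} = ⋃ n : ℕ, {x ∈ Q | r + 1 / ((n : ℝ) + 1) < ‖g x‖} := by
    ext x
    simp only [mem_ofPred_eq, mem_iUnion]
    constructor
    · rintro ⟨hx, hr⟩
      obtain ⟨n, hn⟩ := exists_nat_one_div_lt (sub_pos.2 hr)
      exact ⟨n, hx, by linarith⟩
    · rintro ⟨n, hx, hn⟩
      have : 0 < 1 / ((n : ℝ) + 1) := Nat.one_div_pos_of_nat
      exact ⟨hx, by linarith⟩
  have hmono : Monotone fun n : ℕ => {x ∈ Q | r + 1 / ((n : ℝ) + 1) < ‖g x‖} := by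
    rintro m n hmn x ⟨hx, hm⟩
    exact ⟨hx, lt_of_le_of_lt (by gcongr) hm⟩
  rw [hU, hmono.measure_iUnion]
  refine iSup_le fun n => h _ ?_
  have : 0 < 1 / ((n : ℝ) + 1) := Nat.one_div_pos_of_nat
  linarith

lemma exists_volume_setOf_lt_le {g : (Fin d → ℝ) → E} (hg : AEStronglyMeasurable g volume)
    (hQ : MeasurableSet Q) (hQ' : volume Q < ⊤) {M : ENNReal} (hM : 0 < M) :
    ∃ r : ℝ, 0 ≤ r ∧ volume {x ∈ Q | r < ‖g x‖} ≤ M := by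
  have hmeas : ∀ n : ℕ, NullMeasurableSet {x ∈ Q | (n : ℝ) < ‖g x‖} volume := fun n =>
    hQ.nullMeasurableSet.inter (nullMeasurableSet_lt aemeasurable_const hg.norm.aemeasurable)
  have hanti : Antitone fun n : ℕ => {x ∈ Q | (n : ℝ) < ‖g x‖} := by
    rintro m n hmn x ⟨hx, hn⟩
    exact ⟨hx, lt_of_le_of_lt (by exact_mod_cast hmn) hn⟩
  have hlim := tendsto_measure_iInter_atTop hmeas hanti
    ⟨0, ((measure_mono fun _ hx => hx.1).trans_lt hQ').ne⟩
  have hempty : ⋂ n : ℕ, {x ∈ Q | (n : ℝ) < ‖g x‖} = ∅ := by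
    refine eq_empty_of_forall_notMem fun x hx => ?_
    obtain ⟨n, hn⟩ := exists_nat_gt ‖g x‖
    exact lt_asymm hn (mem_iInter.1 hx n).2
  rw [hempty, measure_empty] at hlim
  obtain ⟨n, hn⟩ := (hlim.eventually_lt_const hM).exists
  exact ⟨n, Nat.cast_nonneg n, hn.le⟩

lemma leastBound_nonneg (lam : ℝ) (g : (Fin d → ℝ) → E) (Q : Set (Fin d → ℝ)) :
    0 ≤ leastBound lam g Q :=
  Real.sInf_nonneg fun _ hr => hr.1

lemma leastBound_le {lam : ℝ} {g : (Fin d → ℝ) → E} {r : ℝ} (hr : 0 ≤ r)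
    (h : volume {x ∈ Q | r < ‖g x‖} ≤ ENNReal.ofReal lam * volume Q) :
    leastBound lam g Q ≤ r :=
  csInf_le ⟨0, fun _ hs => hs.1⟩ ⟨hr, h⟩

lemma localOsc_nonneg (lam : ℝ) (f : (Fin d → ℝ) → E) (Q : Set (Fin d → ℝ)) :
    0 ≤ localOsc lam f Q :=
  Real.iInf_nonneg fun _ => leastBound_nonneg _ _ _

lemma localOsc_le_leastBound (lam : ℝ) (f : (Fin d → ℝ) → E) (Q : Set (Fin d → ℝ)) (c : E) :
    localOsc lam f Q ≤ leastBound lam (fun x => f x - c) Q :=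
  ciInf_le ⟨0, by rintro _ ⟨c, rfl⟩; exact leastBound_nonneg _ _ _⟩ c

lemma volume_setOf_lt_le_of_leastBound_le {lam : ℝ} (hlam : 0 < lam) {g : (Fin d → ℝ) → E}
    (hg : AEStronglyMeasurable g volume) (hQ : MeasurableSet Q) (hQ0 : 0 < volume Q)
    (hQ' : volume Q < ⊤) {r : ℝ} (hr : leastBound lam g Q ≤ r) :
    volume {x ∈ Q | r < ‖g x‖} ≤ ENNReal.ofReal lam * volume Q := by
  refine volume_setOf_lt_le_of_forall_lt fun s hs => ?_
  obtain ⟨t, ht, hts⟩ := exists_lt_of_csInf_lt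
    (exists_volume_setOf_lt_le hg hQ hQ'
      (ENNReal.mul_pos (ENNReal.ofReal_pos.2 hlam).ne' hQ0.ne')) (hr.trans_lt hs)
  have hsub : {x ∈ Q | s < ‖g x‖} ⊆ {x ∈ Q | t < ‖g x‖} := fun x hx => ⟨hx.1, hts.trans hx.2⟩
  exact (measure_mono hsub).trans ht.2

/-- Two vectors that both approximate `f` on `Q` up to a quarter of `Q` are close. -/
lemma norm_sub_le_of_volume_setOf_lt_le {f : (Fin d → ℝ) → E} (hQ0 : 0 < volume Q)
    (hQ' : volume Q < ⊤) {c c' : E} {s t : ℝ}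
    (hs : volume {x ∈ Q | s < ‖f x - c‖} ≤ ENNReal.ofReal (1 / 4) * volume Q)
    (ht : volume {x ∈ Q | t < ‖f x - c'‖} ≤ ENNReal.ofReal (1 / 4) * volume Q) :
    ‖c - c'‖ ≤ s + t := by
  by_contra! hlt
  have hsub : Q ⊆ {x ∈ Q | s < ‖f x - c‖} ∪ {x ∈ Q | t < ‖f x - c'‖} := by
    intro x hx
    by_contra hx'
    simp only [mem_union, mem_ofPred_eq, hx, true_and, not_or, not_lt] at hx'
    have := norm_sub_le (f x - c') (f x - c)
    rw [sub_sub_sub_cancel_left] at this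
    linarith
  have h := calc volume Q ≤ ENNReal.ofReal (1 / 4) * volume Q + ENNReal.ofReal (1 / 4) * volume Q :=
        (measure_mono hsub).trans ((measure_union_le _ _).trans (add_le_add hs ht))
    _ = ENNReal.ofReal (1 / 2) * volume Q := by
        rw [← add_mul, ← ENNReal.ofReal_add (by norm_num) (by norm_num)]
        norm_num
    _ < 1 * volume Q := by
        refine ENNReal.mul_lt_mul_left hQ0.ne' hQ'.ne ?_
        rw [← ENNReal.ofReal_one, ENNReal.ofReal_lt_ofReal_iff one_pos]
        norm_num
  simp at h

/-- Existence of quasi-optimal centers of oscillation. -/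
lemma exists_volume_setOf_two_mul_localOsc_lt_le [CompleteSpace E] {lam : ℝ} (hlam : 0 < lam)
    (hlam' : lam ≤ 1 / 4) {f : (Fin d → ℝ) → E} (hf : AEStronglyMeasurable f volume)
    (hQ : MeasurableSet Q) (hQ0 : 0 < volume Q) (hQ' : volume Q < ⊤) :
    ∃ c : E, volume {x ∈ Q | 2 * localOsc lam f Q < ‖f x - c‖} ≤
      ENNReal.ofReal lam * volume Q := by
  have hfc : ∀ c : E, AEStronglyMeasurable (fun x => f x - c) volume := fun c =>
    hf.sub aestronglyMeasurable_const
  have hexists : ∀ r > localOsc lam f Q, ∃ c : E, volume {x ∈ Q | r < ‖f x - c‖} ≤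
      ENNReal.ofReal lam * volume Q := by
    intro r hr
    obtain ⟨c, hc⟩ := exists_lt_of_ciInf_lt hr
    exact ⟨c, volume_setOf_lt_le_of_leastBound_le hlam (hfc c) hQ hQ0 hQ' hc.le⟩
  rcases (localOsc_nonneg lam f Q).eq_or_lt' with h0 | hpos
  · rw [h0] at hexists ⊢
    choose c hc using fun n : ℕ => hexists (1 / ((n : ℝ) + 1)) Nat.one_div_pos_of_nat
    have hle : ENNReal.ofReal lam * volume Q ≤ ENNReal.ofReal (1 / 4) * volume Q := by gcongr
    have hcauchy : CauchySeq c := by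
      refine cauchySeq_of_le_tendsto_0 (fun n : ℕ => 1 / ((n : ℝ) + 1) + 1 / ((n : ℝ) + 1)) ?_ ?_
      · intro m n N hm hn
        rw [dist_eq_norm]
        refine (norm_sub_le_of_volume_setOf_lt_le hQ0 hQ' ((hc m).trans hle)
          ((hc n).trans hle)).trans ?_
        gcongr
      · simpa using tendsto_one_div_add_atTop_nhds_zero_nat.add
          (tendsto_one_div_add_atTop_nhds_zero_nat (𝕜 := ℝ))
    obtain ⟨c₀, hc₀⟩ := cauchySeq_tendsto_of_complete hcauchy
    refine ⟨c₀, volume_setOf_lt_le_of_forall_lt fun s hs => ?_⟩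
    have hlim := (tendsto_iff_norm_sub_tendsto_zero.1 hc₀).add
      (tendsto_one_div_add_atTop_nhds_zero_nat (𝕜 := ℝ))
    rw [add_zero] at hlim
    obtain ⟨n, hn⟩ := (hlim.eventually_lt_const (by simpa using hs)).exists
    refine (measure_mono ?_).trans (hc n)
    rintro x ⟨hx, hsx⟩
    refine ⟨hx, ?_⟩
    have := norm_add_le (f x - c n) (c n - c₀)
    rw [sub_add_sub_cancel] at this
    linarith
  · exact hexists _ (by linarith)

end LocalOscillation

section StoppingCube

variable {d : ℕ} {a : Fin d → ℝ} {l : ℝ}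
  {bad : Set (Fin d → ℝ) → Set (Fin d → ℝ) → Prop}

open Classical in
/-- The smallest stopping cube that contains the dyadic cube of generation `k` and index `m`. The
cubes of generation `0` are stopping cubes, and a dyadic cube `Q` whose parent lies in the stopping
cube `P` becomes a new stopping cube if `bad P Q`. -/
noncomputable def stoppingCube (a : Fin d → ℝ) (l : ℝ)
    (bad : Set (Fin d → ℝ) → Set (Fin d → ℝ) → Prop) : ℕ → (Fin d → ℕ) → Set (Fin d → ℝ)
  | 0, m => dyadicCube a l 0 m
  | k + 1, m =>
    if bad (stoppingCube a l bad k fun i => m i / 2) (dyadicCube a l (k + 1) m) then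
      dyadicCube a l (k + 1) m
    else stoppingCube a l bad k fun i => m i / 2

/-- The maximal stopping cubes strictly inside the stopping cube `P`. -/
def stoppingChildren (a : Fin d → ℝ) (l : ℝ) (bad : Set (Fin d → ℝ) → Set (Fin d → ℝ) → Prop)
    (P : Set (Fin d → ℝ)) : Set (Set (Fin d → ℝ)) :=
  {Q | ∃ (k : ℕ) (m : Fin d → ℕ), (stoppingCube a l bad k fun i => m i / 2) = P ∧ bad P Q ∧
    Q = dyadicCube a l (k + 1) m}

/-- The stopping cubes among the dyadic subcubes of `cube a l`. -/
def stoppingFamily (a : Fin d → ℝ) (l : ℝ) (bad : Set (Fin d → ℝ) → Set (Fin d → ℝ) → Prop) :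
    Set (Set (Fin d → ℝ)) :=
  {Q | ∃ (k : ℕ) (m : Fin d → ℕ), (∀ i, m i < 2 ^ k) ∧ Q = dyadicCube a l k m ∧
    stoppingCube a l bad k m = Q}

lemma stoppingCube_succ_of_bad {k : ℕ} {m : Fin d → ℕ}
    (h : bad (stoppingCube a l bad k fun i => m i / 2) (dyadicCube a l (k + 1) m)) :
    stoppingCube a l bad (k + 1) m = dyadicCube a l (k + 1) m := by
  rw [stoppingCube, if_pos h]

lemma stoppingCube_succ_of_not_bad {k : ℕ} {m : Fin d → ℕ}
    (h : ¬ bad (stoppingCube a l bad k fun i => m i / 2) (dyadicCube a l (k + 1) m)) :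
    stoppingCube a l bad (k + 1) m = stoppingCube a l bad k fun i => m i / 2 := by
  rw [stoppingCube, if_neg h]

lemma dyadicCube_subset_stoppingCube (hl : 0 < l) (k : ℕ) (m : Fin d → ℕ) :
    dyadicCube a l k m ⊆ stoppingCube a l bad k m := by
  induction k generalizing m with
  | zero => exact subset_rfl
  | succ k ih =>
    by_cases h : bad (stoppingCube a l bad k fun i => m i / 2) (dyadicCube a l (k + 1) m)
    · rw [stoppingCube_succ_of_bad h]
    · rw [stoppingCube_succ_of_not_bad h]
      exact (dyadicCube_succ_subset hl k m).trans (ih _)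

lemma stoppingCube_succ_subset (hl : 0 < l) (k : ℕ) (m : Fin d → ℕ) :
    stoppingCube a l bad (k + 1) m ⊆ stoppingCube a l bad k fun i => m i / 2 := by
  by_cases h : bad (stoppingCube a l bad k fun i => m i / 2) (dyadicCube a l (k + 1) m)
  · rw [stoppingCube_succ_of_bad h]
    exact (dyadicCube_succ_subset hl k m).trans (dyadicCube_subset_stoppingCube hl _ _)
  · rw [stoppingCube_succ_of_not_bad h]

lemma stoppingCube_mem_stoppingFamily {k : ℕ} {m : Fin d → ℕ} (hm : ∀ i, m i < 2 ^ k) :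
    stoppingCube a l bad k m ∈ stoppingFamily a l bad := by
  induction k generalizing m with
  | zero => exact ⟨0, m, hm, rfl, rfl⟩
  | succ k ih =>
    by_cases h : bad (stoppingCube a l bad k fun i => m i / 2) (dyadicCube a l (k + 1) m)
    · exact ⟨k + 1, m, hm, stoppingCube_succ_of_bad h, rfl⟩
    · rw [stoppingCube_succ_of_not_bad h]
      refine ih fun i => ?_
      have := hm i
      rw [pow_succ] at this
      omega

lemma antitone_stoppingCube_dyadicIndex (hl : 0 < l) (x : Fin d → ℝ) :
    Antitone fun k => stoppingCube a l bad k (dyadicIndex a l k x) := by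
  refine antitone_nat_of_succ_le fun k => ?_
  have := stoppingCube_succ_subset (bad := bad) (a := a) hl k (dyadicIndex a l (k + 1) x)
  rwa [dyadicIndex_succ_div_two] at this

lemma pairwiseDisjoint_stoppingChildren (hl : 0 < l)
    (hbad : ∀ k m, ¬ bad (dyadicCube a l k m) (dyadicCube a l k m)) (P : Set (Fin d → ℝ)) :
    (stoppingChildren a l bad P).PairwiseDisjoint id := by
  have key : ∀ (x : Fin d → ℝ) (k k' : ℕ), k < k' →
      stoppingCube a l bad k (dyadicIndex a l k x) = P →
      bad P (dyadicCube a l (k + 1) (dyadicIndex a l (k + 1) x)) →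
      stoppingCube a l bad k' (dyadicIndex a l k' x) ≠ P := by
    intro x k k' hkk' hk hkb hk'
    have h1 : stoppingCube a l bad (k + 1) (dyadicIndex a l (k + 1) x) =
        dyadicCube a l (k + 1) (dyadicIndex a l (k + 1) x) := by
      apply stoppingCube_succ_of_bad
      rwa [dyadicIndex_succ_div_two, hk]
    have h2 := antitone_stoppingCube_dyadicIndex (a := a) (bad := bad) hl x k.le_succ
    have h3 := antitone_stoppingCube_dyadicIndex (a := a) (bad := bad) hl x
      (Nat.succ_le_of_lt hkk')
    simp only [Nat.succ_eq_add_one, hk, hk', h1] at h2 h3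
    have hP := subset_antisymm h3 h2
    exact hbad (k + 1) (dyadicIndex a l (k + 1) x) (by rwa [hP] at hkb)
  rintro Q ⟨k, m, hk, hkb, rfl⟩ Q' ⟨k', m', hk', hkb', rfl⟩ hne
  refine disjoint_left.2 fun x hx hx' => ?_
  obtain ⟨-, rfl⟩ := (mem_dyadicCube_iff hl).1 hx
  obtain ⟨-, rfl⟩ := (mem_dyadicCube_iff hl).1 hx'
  rw [dyadicIndex_succ_div_two] at hk hk'
  rcases lt_trichotomy k k' with h | rfl | h
  · exact key x k k' h hk hkb hk'
  · exact hne rfl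
  · exact key x k' k h hk' hkb' hk

lemma stoppingCube_dyadicIndex_eq_of_notMem_stoppingChildren (hl : 0 < l) {P : Set (Fin d → ℝ)}
    {x : Fin d → ℝ} (hax : a ≤ x) (hx : x ∉ ⋃₀ stoppingChildren a l bad P) {k : ℕ}
    (hk : stoppingCube a l bad k (dyadicIndex a l k x) = P) {j : ℕ} (hj : k ≤ j) :
    stoppingCube a l bad j (dyadicIndex a l j x) = P := by
  induction j, hj using Nat.le_induction with
  | base => exact hk
  | succ j _ ih =>
    rw [stoppingCube_succ_of_not_bad, dyadicIndex_succ_div_two, ih]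
    rw [dyadicIndex_succ_div_two, ih]
    intro hb
    exact hx ⟨_, ⟨j, dyadicIndex a l (j + 1) x, by rw [dyadicIndex_succ_div_two, ih], hb, rfl⟩,
      (mem_dyadicCube_iff hl).2 ⟨hax, rfl⟩⟩

lemma pairwise_stoppingFamily_diff_stoppingChildren (hl : 0 < l) :
    (stoppingFamily a l bad).Pairwise fun Q Q' =>
      (Q \ ⋃₀ stoppingChildren a l bad Q) ∩ (Q' \ ⋃₀ stoppingChildren a l bad Q') = ∅ := by
  rintro Q ⟨k, m, -, hQ, hk⟩ Q' ⟨k', m', -, hQ', hk'⟩ hne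
  refine eq_empty_of_forall_notMem fun x ⟨⟨hx, hxc⟩, hx', hxc'⟩ => hne ?_
  rw [hQ, mem_dyadicCube_iff hl] at hx
  rw [hQ', mem_dyadicCube_iff hl] at hx'
  rw [← hx.2] at hk
  rw [← hx'.2] at hk'
  rw [← stoppingCube_dyadicIndex_eq_of_notMem_stoppingChildren hl hx.1 hxc hk (le_max_left k k'),
    stoppingCube_dyadicIndex_eq_of_notMem_stoppingChildren hl hx'.1 hxc' hk' (le_max_right k k')]

lemma countable_stoppingFamily : (stoppingFamily a l bad).Countable := by
  refine (countable_range fun p : ℕ × (Fin d → ℕ) => dyadicCube a l p.1 p.2).mono ?_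
  rintro Q ⟨k, m, -, rfl, -⟩
  exact ⟨(k, m), rfl⟩

lemma countable_stoppingChildren (P : Set (Fin d → ℝ)) :
    (stoppingChildren a l bad P).Countable := by
  refine (countable_range fun p : ℕ × (Fin d → ℕ) => dyadicCube a l (p.1 + 1) p.2).mono ?_
  rintro Q ⟨k, m, -, -, rfl⟩
  exact ⟨(k, m), rfl⟩

lemma measurableSet_of_mem_stoppingChildren {P Q : Set (Fin d → ℝ)}
    (hQ : Q ∈ stoppingChildren a l bad P) : MeasurableSet Q := by
  obtain ⟨k, m, -, -, rfl⟩ := hQ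
  exact measurableSet_dyadicCube _ _

lemma measurableSet_sUnion_stoppingChildren (P : Set (Fin d → ℝ)) :
    MeasurableSet (⋃₀ stoppingChildren a l bad P) :=
  .sUnion (countable_stoppingChildren P) fun _ => measurableSet_of_mem_stoppingChildren

/-- If every child of `P` meets `B` in a large portion and `B` is small, then the children of `P`
leave a large portion of `P` uncovered. -/
lemma le_volume_diff_stoppingChildren (hl : 0 < l)
    (hbad : ∀ k m, ¬ bad (dyadicCube a l k m) (dyadicCube a l k m)) {ν : ℝ} (hν0 : 0 ≤ ν)
    (hν1 : ν ≤ 1) {P B : Set (Fin d → ℝ)} (hP : volume P ≠ ⊤)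
    (hB : volume B ≤ ENNReal.ofReal ((1 - ν) / 2 ^ (d + 2)) * volume P)
    (hPB : ∀ Q, bad P Q → volume Q ≤ 2 ^ (d + 2) * volume (B ∩ Q)) :
    ENNReal.ofReal ν * volume P ≤ volume (P \ ⋃₀ stoppingChildren a l bad P) := by
  set 𝒞 := stoppingChildren a l bad P
  have hcount : 𝒞.Countable := countable_stoppingChildren P
  have hU := calc
    volume (⋃₀ 𝒞) ≤ ∑' Q : 𝒞, volume (Q : Set (Fin d → ℝ)) := by
        rw [sUnion_eq_biUnion]
        exact measure_biUnion_le _ hcount _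
    _ ≤ ∑' Q : 𝒞, 2 ^ (d + 2) * volume.restrict B (Q : Set (Fin d → ℝ)) := by
        refine ENNReal.tsum_le_tsum fun ⟨Q, hQ⟩ => ?_
        rw [Measure.restrict_apply (measurableSet_of_mem_stoppingChildren hQ), inter_comm]
        obtain ⟨k, m, -, hb, -⟩ := hQ
        exact hPB Q hb
    _ = 2 ^ (d + 2) * volume.restrict B (⋃₀ 𝒞) := by
        rw [ENNReal.tsum_mul_left, measure_sUnion hcount
          (pairwiseDisjoint_stoppingChildren hl hbad P)
          fun _ => measurableSet_of_mem_stoppingChildren]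
    _ ≤ 2 ^ (d + 2) * (ENNReal.ofReal ((1 - ν) / 2 ^ (d + 2)) * volume P) := by
        gcongr
        exact (measure_mono (subset_univ _)).trans (Measure.restrict_apply_univ B ▸ hB)
    _ = ENNReal.ofReal (1 - ν) * volume P := by
        rw [← mul_assoc, ← ENNReal.ofReal_ofNat 2, ← ENNReal.ofReal_pow (by norm_num),
          ← ENNReal.ofReal_mul (by positivity), mul_div_cancel₀ _ (by positivity)]
  have hfin : ENNReal.ofReal (1 - ν) * volume P ≠ ⊤ := ENNReal.mul_ne_top ENNReal.ofReal_ne_top hP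
  refine ENNReal.le_of_add_le_add_right hfin ?_
  rw [← add_mul, ← ENNReal.ofReal_add hν0 (sub_nonneg.2 hν1), add_sub_cancel, ENNReal.ofReal_one,
    one_mul]
  calc volume P ≤ volume (P \ ⋃₀ 𝒞 ∪ ⋃₀ 𝒞) := measure_mono (by simp)
    _ ≤ _ := (measure_union_le _ _).trans (by gcongr)

lemma stoppingCube_succ_eq_or (k : ℕ) (x : Fin d → ℝ) :
    stoppingCube a l bad (k + 1) (dyadicIndex a l (k + 1) x) =
        stoppingCube a l bad k (dyadicIndex a l k x) ∨
      stoppingCube a l bad (k + 1) (dyadicIndex a l (k + 1) x) =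
        dyadicCube a l (k + 1) (dyadicIndex a l (k + 1) x) := by
  by_cases h : bad (stoppingCube a l bad k fun i => dyadicIndex a l (k + 1) x i / 2)
      (dyadicCube a l (k + 1) (dyadicIndex a l (k + 1) x))
  · exact .inr (stoppingCube_succ_of_bad h)
  · rw [stoppingCube_succ_of_not_bad h, dyadicIndex_succ_div_two]
    exact .inl rfl

end StoppingCube

/-- In a nearly disjoint countable collection of subsets of a set of finite measure, almost every
point lies in finitely many members. -/
lemma PairwiseNearlyDisjoint.ae_finite_setOf_mem {d : ℕ} {ν : ℝ} (hν : 0 < ν)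
    {S : Set (Set (Fin d → ℝ))} (hS : PairwiseNearlyDisjoint ν S) (hcount : S.Countable)
    {K : Set (Fin d → ℝ)} (hK : volume K ≠ ⊤) (hSK : ∀ Q ∈ S, Q ⊆ K) :
    ∀ᵐ x : Fin d → ℝ, {Q ∈ S | x ∈ Q}.Finite := by
  obtain ⟨sel, hsel, hdisj⟩ := hS
  have : Countable S := hcount
  have hν' : ENNReal.ofReal ν ≠ 0 := (ENNReal.ofReal_pos.2 hν).ne'
  have hsum : ∑' Q : S, volume (Q : Set (Fin d → ℝ)) ≠ ⊤ := by
    have hle : ENNReal.ofReal ν * ∑' Q : S, volume (Q : Set (Fin d → ℝ)) ≤ volume K := by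
      rw [← ENNReal.tsum_mul_left]
      calc ∑' Q : S, ENNReal.ofReal ν * volume (Q : Set (Fin d → ℝ))
          ≤ ∑' Q : S, volume (sel Q) := ENNReal.tsum_le_tsum fun Q => (hsel Q Q.2).2.2
        _ ≤ volume (⋃ Q : S, sel Q) := by
          refine tsum_meas_le_meas_iUnion_of_disjoint _ (fun Q => (hsel Q Q.2).1) ?_
          intro Q Q' hne
          exact disjoint_iff_inter_eq_empty.2 (hdisj Q.2 Q'.2 (Subtype.coe_injective.ne hne))
        _ ≤ volume K :=
          measure_mono (iUnion_subset fun Q => (hsel Q Q.2).2.1.trans (hSK Q Q.2))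
    intro htop
    rw [htop, ENNReal.mul_top hν'] at hle
    exact hK (top_le_iff.1 hle)
  filter_upwards [ae_finite_setOfPred_mem hsum] with x hx
  refine (hx.image Subtype.val).subset ?_
  rintro Q ⟨hQ, hxQ⟩
  exact ⟨⟨Q, hQ⟩, hxQ, rfl⟩

/-- Telescoping along a decreasing chain of sets that contain `x`. -/
lemma exists_finset_norm_sub_add_le {E α : Type*} [NormedAddCommGroup E] {c : Set α → E}
    {r : Set α → ℝ} (hr : ∀ P, 0 ≤ r P) {S : Set (Set α)} {x : α} {X : ℕ → Set α}
    (hX : Antitone X) (hXS : ∀ k, X k ∈ S) (hxX : ∀ k, x ∈ X k)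
    (hstep : ∀ k, X (k + 1) ≠ X k → ‖c (X k) - c (X (k + 1))‖ ≤ r (X k) + r (X (k + 1))) (k : ℕ) :
    ∃ T : Finset (Set α), (∀ Q ∈ T, Q ∈ S ∧ x ∈ Q ∧ X k ⊆ Q) ∧ X 0 ∈ T ∧
      ‖c (X 0) - c (X k)‖ + r (X k) ≤ 2 * ∑ Q ∈ T, r Q := by
  classical
  induction k with
  | zero =>
    refine ⟨{X 0}, by simp [hXS, hxX], by simp, ?_⟩
    rw [sub_self, norm_zero, Finset.sum_singleton]
    linarith [hr (X 0)]
  | succ k ih =>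
    obtain ⟨T, hT, h0, hle⟩ := ih
    by_cases heq : X (k + 1) = X k
    · exact ⟨T, by rwa [heq], h0, by rwa [heq]⟩
    · have hnot : X (k + 1) ∉ T := fun h =>
        heq (subset_antisymm (hX k.le_succ) (hT _ h).2.2)
      refine ⟨insert (X (k + 1)) T, ?_, Finset.mem_insert_of_mem h0, ?_⟩
      · intro Q hQ
        rcases Finset.mem_insert.1 hQ with rfl | hQ
        · exact ⟨hXS _, hxX _, subset_rfl⟩
        · exact ⟨(hT Q hQ).1, (hT Q hQ).2.1, (hX k.le_succ).trans (hT Q hQ).2.2⟩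
      · rw [Finset.sum_insert hnot]
        have := norm_sub_le_norm_sub_add_norm_sub (c (X 0)) (c (X k)) (c (X (k + 1)))
        linarith [hstep k heq]

lemma Antitone.exists_eq_of_finite_range {β : Type*} [PartialOrder β] {X : ℕ → β}
    (hX : Antitone X) (hfin : (range X).Finite) : ∃ k, ∀ j ≥ k, X j = X k := by
  obtain ⟨_, ⟨k, rfl⟩, hk⟩ := hfin.exists_minimal (range_nonempty X)
  exact ⟨k, fun j hj => le_antisymm (hX hj) (hk ⟨j, rfl⟩ (hX hj))⟩

lemma le_ofReal_quarter_mul_of_two_pow_mul_le {d : ℕ} {u v : ENNReal}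
    (h : 2 ^ (d + 2) * u ≤ v) : u ≤ ENNReal.ofReal (1 / 4) * v := by
  have h4 : ENNReal.ofReal (1 / 4) * 4 = 1 := by
    rw [← ENNReal.ofReal_ofNat 4, ← ENNReal.ofReal_mul (by norm_num)]
    norm_num
  have hd : (4 : ENNReal) ≤ 2 ^ (d + 2) := by
    rw [show (4 : ENNReal) = 2 ^ 2 by norm_num]
    exact pow_le_pow_right₀ (by norm_num) (by omega)
  calc u = ENNReal.ofReal (1 / 4) * (4 * u) := by rw [← mul_assoc, h4, one_mul]
    _ ≤ ENNReal.ofReal (1 / 4) * (2 ^ (d + 2) * u) := by gcongr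
    _ ≤ ENNReal.ofReal (1 / 4) * v := by gcongr

lemma volume_inter_dyadicCube_le_of_stoppingCube {d : ℕ} {a : Fin d → ℝ} {l : ℝ}
    {B : Set (Fin d → ℝ) → Set (Fin d → ℝ)}
    (hB : ∀ k m, 2 ^ (d + 2) * volume (B (dyadicCube a l k m) ∩ dyadicCube a l k m) ≤
      volume (dyadicCube a l k m)) (k : ℕ) (m : Fin d → ℕ) :
    2 ^ (d + 2) * volume
        (B (stoppingCube a l (fun P Q => volume Q < 2 ^ (d + 2) * volume (B P ∩ Q)) k m) ∩
          dyadicCube a l k m) ≤ volume (dyadicCube a l k m) := by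
  set bad : Set (Fin d → ℝ) → Set (Fin d → ℝ) → Prop :=
    fun P Q => volume Q < 2 ^ (d + 2) * volume (B P ∩ Q)
  cases k with
  | zero => exact hB 0 m
  | succ k =>
    by_cases h : bad (stoppingCube a l bad k fun i => m i / 2) (dyadicCube a l (k + 1) m)
    · rw [stoppingCube_succ_of_bad h]
      exact hB _ _
    · rw [stoppingCube_succ_of_not_bad h]
      exact not_lt.1 h

/-- vector-valued Lerner local oscillation decomposition: there is a
pairwise nearly disjoint (with parameter `ν`) collection `S` of dyadic subcubes of `Q⁰`
such that for a.e. `x ∈ Q⁰` and every quasi-optimal center of oscillation `c` of `f` on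
`Q⁰` with a `1/4`-portion disregarded,
`‖f x - c‖ ≤ 12 ∑_{Q ∈ S} ω_{(1-ν) 2^{-d-2}}(f;Q) 1_Q(x)`. -/
theorem lerner_decomposition {E : Type*} [NormedAddCommGroup E] [NormedSpace ℝ E]
    [CompleteSpace E] {d : ℕ} (hd : 1 ≤ d) (ν : ℝ) (hν0 : 0 < ν) (hν1 : ν < 1)
    (f : (Fin d → ℝ) → E) (hf : AEStronglyMeasurable f volume)
    (a : Fin d → ℝ) (l : ℝ) (hl : 0 < l) :
    ∃ S : Set (Set (Fin d → ℝ)),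
      (∀ Q ∈ S, IsDyadicSubcube a l Q) ∧
      PairwiseNearlyDisjoint ν S ∧
      ∀ᵐ x : Fin d → ℝ, x ∈ cube a l →
        ∀ c : E, IsQuasiCenter (1 / 4) f (cube a l) c →
          ENNReal.ofReal ‖f x - c‖ ≤
            12 * ∑' Q : S, (Q : Set (Fin d → ℝ)).indicator
              (fun _ => ENNReal.ofReal (localOsc ((1 - ν) / 2 ^ (d + 2)) f Q)) x := by
  set lam : ℝ := (1 - ν) / 2 ^ (d + 2) with hlam
  have hlam0 : 0 < lam := div_pos (sub_pos.2 hν1) (by positivity)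
  have hlam2 : 2 ^ (d + 2) * ENNReal.ofReal lam ≤ 1 := by
    rw [← ENNReal.ofReal_ofNat 2, ← ENNReal.ofReal_pow (by norm_num),
      ← ENNReal.ofReal_mul (by positivity), hlam, mul_div_cancel₀ _ (by positivity),
      ENNReal.ofReal_le_one]
    linarith
  have hlam4 : lam ≤ 1 / 4 := by
    rw [hlam, div_le_iff₀ (by positivity), pow_add]
    have : (1 : ℝ) ≤ 2 ^ d := one_le_pow₀ (by norm_num)
    linarith
  -- quasi-optimal centers `c P` and the exceptional sets `B P`
  have hex : ∀ P : Set (Fin d → ℝ), ∃ c : E,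
      MeasurableSet P → 0 < volume P → volume P < ⊤ →
        volume {x ∈ P | 2 * localOsc lam f P < ‖f x - c‖} ≤ ENNReal.ofReal lam * volume P := by
    intro P
    by_cases h : MeasurableSet P ∧ 0 < volume P ∧ volume P < ⊤
    · obtain ⟨c, hc⟩ :=
        exists_volume_setOf_two_mul_localOsc_lt_le hlam0 hlam4 hf h.1 h.2.1 h.2.2
      exact ⟨c, fun _ _ _ => hc⟩
    · exact ⟨0, fun h1 h2 h3 => absurd ⟨h1, h2, h3⟩ h⟩
  choose c hc using hex
  set r : Set (Fin d → ℝ) → ℝ := fun P => 2 * localOsc lam f P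
  have hr : ∀ P, 0 ≤ r P := fun P => mul_nonneg zero_le_two (localOsc_nonneg _ _ _)
  set B : Set (Fin d → ℝ) → Set (Fin d → ℝ) := fun P => {x ∈ P | r P < ‖f x - c P‖}
  have hBvol : ∀ k m, volume (B (dyadicCube a l k m)) ≤
      ENNReal.ofReal lam * volume (dyadicCube a l k m) := fun k m =>
    hc _ (measurableSet_dyadicCube k m) (volume_dyadicCube_pos hl k m)
      (volume_dyadicCube_lt_top k m)
  have hBself : ∀ k m, 2 ^ (d + 2) * volume (B (dyadicCube a l k m) ∩ dyadicCube a l k m) ≤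
      volume (dyadicCube a l k m) := by
    intro k m
    calc 2 ^ (d + 2) * volume (B (dyadicCube a l k m) ∩ dyadicCube a l k m)
        ≤ 2 ^ (d + 2) * (ENNReal.ofReal lam * volume (dyadicCube a l k m)) := by
          gcongr
          exact (measure_mono inter_subset_left).trans (hBvol k m)
      _ ≤ 1 * volume (dyadicCube a l k m) := by
          rw [← mul_assoc]
          gcongr
      _ = _ := one_mul _
  set bad : Set (Fin d → ℝ) → Set (Fin d → ℝ) → Prop :=
    fun P Q => volume Q < 2 ^ (d + 2) * volume (B P ∩ Q)
  have hbad : ∀ k m, ¬ bad (dyadicCube a l k m) (dyadicCube a l k m) := fun k m =>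
    not_lt.2 (hBself k m)
  have hBstop := volume_inter_dyadicCube_le_of_stoppingCube hBself
  have hnear : PairwiseNearlyDisjoint ν (stoppingFamily a l bad) := by
    refine ⟨fun P => P \ ⋃₀ stoppingChildren a l bad P, ?_,
      pairwise_stoppingFamily_diff_stoppingChildren hl⟩
    rintro _ ⟨k, m, -, rfl, -⟩
    exact ⟨(measurableSet_dyadicCube k m).diff (measurableSet_sUnion_stoppingChildren _),
      sdiff_subset, le_volume_diff_stoppingChildren hl hbad hν0.le hν1.le
        (volume_dyadicCube_lt_top k m).ne (hBvol k m) fun Q hQ => hQ.le⟩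
  have hcube : dyadicCube a l 0 0 = cube a l := dyadicCube_zero_zero
  refine ⟨stoppingFamily a l bad, ?_, hnear, ?_⟩
  · rintro Q ⟨k, m, hm, hQ, -⟩
    exact ⟨k, m, hm, hQ⟩
  have hfinite := hnear.ae_finite_setOf_mem hν0 countable_stoppingFamily
    (K := cube a l) (hcube ▸ (volume_dyadicCube_lt_top 0 0).ne) (by
      rintro _ ⟨k, m, hm, rfl, -⟩
      exact dyadicCube_subset_cube hl hm)
  have hdensity : ∀ᵐ x : Fin d → ℝ, ∀ P ∈ stoppingFamily a l bad, x ∈ B P → a ≤ x →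
      Filter.Tendsto (fun k => volume (B P ∩ dyadicCube a l k (dyadicIndex a l k x)) /
        volume (dyadicCube a l k (dyadicIndex a l k x))) Filter.atTop (nhds 1) :=
    (ae_ball_iff countable_stoppingFamily).2 fun P _ =>
      ae_tendsto_volume_inter_dyadicCube_div hl (B P)
  filter_upwards [hfinite, hdensity] with x hxfin hxdens hx b hb
  have hx0 : a ≤ x ∧ dyadicIndex a l 0 x = 0 := by
    rwa [← hcube, mem_dyadicCube_iff hl] at hx
  have hxmem : ∀ k, x ∈ dyadicCube a l k (dyadicIndex a l k x) := fun k =>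
    (mem_dyadicCube_iff hl).2 ⟨hx0.1, rfl⟩
  -- the smallest stopping cubes along the dyadic cubes shrinking to `x`
  set X : ℕ → Set (Fin d → ℝ) := fun k => stoppingCube a l bad k (dyadicIndex a l k x)
  have hXanti : Antitone X := antitone_stoppingCube_dyadicIndex hl x
  have hXS : ∀ k, X k ∈ stoppingFamily a l bad := fun k =>
    stoppingCube_mem_stoppingFamily (dyadicIndex_lt hl hx k)
  have hxX : ∀ k, x ∈ X k := fun k => dyadicCube_subset_stoppingCube hl _ _ (hxmem k)
  have hX0 : X 0 = cube a l := by
    simp only [X, hx0.2]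
    exact hcube
  obtain ⟨k, hk⟩ := hXanti.exists_eq_of_finite_range
    (hxfin.subset (by rintro _ ⟨k, rfl⟩; exact ⟨hXS k, hxX k⟩))
  have hxB : ‖f x - c (X k)‖ ≤ r (X k) := by
    by_contra! hlt
    have hlim := hxdens (X k) (hXS k) ⟨hxX k, hlt⟩ hx0.1
    have hle : (1 : ENNReal) ≤ ENNReal.ofReal (1 / 4) := by
      refine le_of_tendsto hlim (Filter.eventually_atTop.2 ⟨k, fun j hj => ?_⟩)
      refine ENNReal.div_le_of_le_mul ?_
      have h := hBstop j (dyadicIndex a l j x)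
      rw [show stoppingCube a l bad j (dyadicIndex a l j x) = X k from hk j hj] at h
      exact le_ofReal_quarter_mul_of_two_pow_mul_le h
    rw [ENNReal.one_le_ofReal] at hle
    norm_num at hle
  have hstep : ∀ k, X (k + 1) ≠ X k → ‖c (X k) - c (X (k + 1))‖ ≤ r (X k) + r (X (k + 1)) := by
    intro k hne
    have hQ := (stoppingCube_succ_eq_or k x).resolve_left hne
    change X (k + 1) = _ at hQ
    set Q := dyadicCube a l (k + 1) (dyadicIndex a l (k + 1) x)
    rw [hQ]
    have hQX : Q ⊆ X k := hQ ▸ hXanti k.le_succ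
    have hQk : Q ⊆ dyadicCube a l k (dyadicIndex a l k x) := by
      have := dyadicCube_succ_subset (a := a) hl k (dyadicIndex a l (k + 1) x)
      rwa [dyadicIndex_succ_div_two] at this
    refine norm_sub_le_of_volume_setOf_lt_le (f := f) (volume_dyadicCube_pos hl _ _)
      (volume_dyadicCube_lt_top _ _) ?_ ((hBvol _ _).trans (by gcongr))
    have hsub : {y ∈ Q | r (X k) < ‖f y - c (X k)‖} ⊆
        B (X k) ∩ dyadicCube a l k (dyadicIndex a l k x) := fun y hy =>
      ⟨⟨hQX hy.1, hy.2⟩, hQk hy.1⟩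
    have h : 2 ^ (d + 2) * volume (B (X k) ∩ dyadicCube a l k (dyadicIndex a l k x)) ≤
        volume (dyadicCube a l k (dyadicIndex a l k x)) := hBstop k _
    rw [volume_dyadicCube_eq_two_pow_mul_succ k _ (dyadicIndex a l (k + 1) x), pow_add, mul_assoc,
      ENNReal.mul_le_mul_iff_right (by positivity) (by finiteness)] at h
    refine (measure_mono hsub).trans (le_ofReal_quarter_mul_of_two_pow_mul_le (d := 0) ?_)
    rwa [zero_add]
  obtain ⟨T, hT, h0T, hle⟩ := exists_finset_norm_sub_add_le hr hXanti hXS hxX hstep k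
  have hbc : ‖b - c (X 0)‖ ≤ 3 * r (X 0) := by
    have hpos : 0 < volume (cube a l) := hcube ▸ volume_dyadicCube_pos hl 0 0
    have htop : volume (cube a l) < ⊤ := hcube ▸ volume_dyadicCube_lt_top 0 0
    have hcB : volume (B (cube a l)) ≤ ENNReal.ofReal (1 / 4) * volume (cube a l) := by
      rw [← hcube]
      exact (hBvol 0 0).trans (by gcongr)
    have hosc : leastBound (1 / 4) (fun x => f x - b) (cube a l) ≤ 2 * r (cube a l) :=
      hb.trans (mul_le_mul_of_nonneg_left
        ((localOsc_le_leastBound _ _ _ _).trans (leastBound_le (hr _) hcB)) zero_le_two)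
    have := norm_sub_le_of_volume_setOf_lt_le hpos htop
      (volume_setOf_lt_le_of_leastBound_le (by norm_num) (hf.sub aestronglyMeasurable_const)
        (hcube ▸ measurableSet_dyadicCube 0 0) hpos htop hosc) hcB
    rw [hX0]
    linarith
  have hsum : ‖f x - b‖ ≤ 12 * ∑ Q ∈ T, localOsc lam f Q := by
    have h1 := norm_sub_le_norm_sub_add_norm_sub (f x) (c (X k)) b
    have h2 := norm_sub_le_norm_sub_add_norm_sub (c (X k)) (c (X 0)) b
    rw [norm_sub_rev] at hle hbc
    have h3 := Finset.single_le_sum (fun Q _ => hr Q) h0T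
    have h4 : ∑ Q ∈ T, r Q = 2 * ∑ Q ∈ T, localOsc lam f Q := (Finset.mul_sum _ _ _).symm
    have h5 : 0 ≤ ∑ Q ∈ T, localOsc lam f Q := Finset.sum_nonneg fun Q _ => localOsc_nonneg _ _ _
    linarith
  calc ENNReal.ofReal ‖f x - b‖ ≤ ENNReal.ofReal (12 * ∑ Q ∈ T, localOsc lam f Q) :=
        ENNReal.ofReal_le_ofReal hsum
    _ = 12 * ∑ Q ∈ T, Q.indicator (fun _ => ENNReal.ofReal (localOsc lam f Q)) x := by
        rw [ENNReal.ofReal_mul (by norm_num), ENNReal.ofReal_ofNat,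
          ENNReal.ofReal_sum_of_nonneg fun Q _ => localOsc_nonneg _ _ _]
        congr 1
        exact Finset.sum_congr rfl fun Q hQ => by rw [indicator_of_mem (hT Q hQ).2.1]
    _ ≤ _ := by
        classical
        gcongr
        rw [← Finset.sum_subtype_of_mem
          (fun Q : Set (Fin d → ℝ) => Q.indicator (fun _ => ENNReal.ofReal (localOsc lam f Q)) x)
          fun Q hQ => (hT Q hQ).1]
        exact ENNReal.sum_le_tsum _
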